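/- Let L be the entire continuation of the Cantor Dirichlet series (assumed to exist) and set C_ν = ∑_{n≥1} r(n)²/n. Then there is a constant K such that for all T ≥ 2, |∫_T^{2T} |L(1/2 + it)|² dt − C_ν·T| ≤ K·T^{1−d/2}. In particular the second moment on the critical line is asymptotic to C_ν·T, with no logarithmic factor. -/

import Mathlib

open Complex Real

/-- `r(n) = ∏_{j=1}^∞ cos(3n/(4·3^j))`: the real cosine product giving the
Fourier coefficients of the ternary Cantor measure rescaled to `[0.5, 2.0]`. -/
noncomputable def cantorR (n : ℕ) : ℝ :=
  ∏' j : ℕ, Real.cos (3 * n / (4 * 3 ^ (j + 1)))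

/-- `â(n) = e^{i(5/4)n} r(n)`: the Fourier coefficients of the rescaled ternary
Cantor measure. -/
noncomputable def cantorA (n : ℕ) : ℂ :=
  Complex.exp (Complex.I * (5 / 4) * n) * (cantorR n : ℂ)

/-- The Cantor Dirichlet series `∑_{n≥1} â(n) n^{-s}` (as a `tsum`). -/
noncomputable def cantorSeries (s : ℂ) : ℂ :=
  ∑' n : ℕ, cantorA (n + 1) * ((n + 1 : ℕ) : ℂ) ^ (-s)

/-- `d = log 2 / log 3`, the Hausdorff dimension of the ternary Cantor set. -/
noncomputable def cantorDim : ℝ := Real.log 2 / Real.log 3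

lemma aux_tendsto (n : ℕ) : Filter.Tendsto
    (fun k : ℕ => ∏ j ∈ Finset.range k, Real.cos (n * (1 / 4 / 3 ^ j))) Filter.atTop
    (nhds (cantorR n)) := by
  have heq : ∀ j : ℕ, Real.cos (3 * n / (4 * 3 ^ (j + 1))) = Real.cos (n * (1 / 4 / 3 ^ j)) := by
    intro j
    congr 1
    rw [pow_succ]
    field_simp
  have hs : Summable (fun j : ℕ => ‖Real.cos (n * (1 / 4 / 3 ^ j)) - 1‖) := by
    refine Summable.of_nonneg_of_le (fun _ => norm_nonneg _)
      (f := fun j : ℕ => ((n : ℝ) ^ 2 / 32) * (1 / 9) ^ j) ?_ ?_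
    · intro j
      have h1 := Real.one_sub_sq_div_two_le_cos (x := (n * (1 / 4 / 3 ^ j) : ℝ))
      have h2 := Real.cos_le_one (n * (1 / 4 / 3 ^ j) : ℝ)
      rw [Real.norm_eq_abs, abs_sub_comm, abs_of_nonneg (by linarith)]
      have : ((n * (1 / 4 / 3 ^ j) : ℝ)) ^ 2 / 2 = ((n : ℝ) ^ 2 / 32) * (1 / 9) ^ j := by
        have : (9 : ℝ) ^ j = (3 ^ j) ^ 2 := by rw [← pow_mul, mul_comm, pow_mul]; norm_num
        rw [one_div_pow, this]
        field_simp
        ring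
      linarith
    · exact (summable_geometric_of_lt_one (by norm_num) (by norm_num)).mul_left _
  have hm : Multipliable (fun j : ℕ => Real.cos (n * (1 / 4 / 3 ^ j))) := by
    have := multipliable_one_add_of_summable hs
    simpa using this
  have := hm.hasProd.tendsto_prod_nat
  unfold cantorR
  simp_rw [heq]
  exact this

lemma aux_conv (S : Finset ℕ) (B : ℝ) (u : ℕ → ℝ) (hu : ∀ j, 0 ≤ u j) :
    ∀ (k : ℕ) (y : ℝ) (c : ℕ → ℂ),
    (∀ x : ℝ, |x - y| ≤ ∑ j ∈ Finset.range k, u j →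
      ‖∑ n ∈ S, c n * Complex.exp (Complex.I * x * n)‖ ≤ B) →
    ‖∑ n ∈ S, c n * Complex.exp (Complex.I * y * n) *
      ((∏ j ∈ Finset.range k, Real.cos (n * u j) : ℝ) : ℂ)‖ ≤ B := by
  intro k
  induction k with
  | zero =>
    intro y c h
    simpa using h y (by simp)
  | succ k ih =>
    intro y c h
    have h1 := ih (y + u k) c (fun x hx => h x (by
      rw [Finset.sum_range_succ]
      have := abs_sub_le x (y + u k) y
      rw [show y + u k - y = u k by ring, abs_of_nonneg (hu k)] at this
      linarith))
    have h2 := ih (y - u k) c (fun x hx => h x (by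
      rw [Finset.sum_range_succ]
      have := abs_sub_le x (y - u k) y
      rw [show y - u k - y = - u k by ring, abs_neg, abs_of_nonneg (hu k)] at this
      linarith))
    have key : ∑ n ∈ S, c n * Complex.exp (Complex.I * y * n) *
        ((∏ j ∈ Finset.range (k + 1), Real.cos (n * u j) : ℝ) : ℂ) =
        (1 / 2) * (∑ n ∈ S, c n * Complex.exp (Complex.I * (y + u k : ℝ) * n) *
          ((∏ j ∈ Finset.range k, Real.cos (n * u j) : ℝ) : ℂ)) +
        (1 / 2) * (∑ n ∈ S, c n * Complex.exp (Complex.I * (y - u k : ℝ) * n) *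
          ((∏ j ∈ Finset.range k, Real.cos (n * u j) : ℝ) : ℂ)) := by
      rw [Finset.mul_sum, Finset.mul_sum, ← Finset.sum_add_distrib]
      refine Finset.sum_congr rfl (fun n _ => ?_)
      rw [Finset.prod_range_succ]
      generalize (∏ j ∈ Finset.range k, Real.cos (n * u j) : ℝ) = P
      push_cast
      rw [Complex.cos, show Complex.I * ((y : ℂ) + u k) * n = Complex.I * y * n + n * u k * Complex.I
        by ring, show Complex.I * ((y : ℂ) - u k) * n = Complex.I * y * n + -(n * u k) * Complex.I
        by ring, Complex.exp_add, Complex.exp_add]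
      ring
    rw [key]
    refine (norm_add_le _ _).trans ?_
    rw [norm_mul, norm_mul]
    have : ‖(1 / 2 : ℂ)‖ = 1 / 2 := by norm_num
    rw [this]
    linarith

lemma aux_geom_window (h : ℝ) (hh : 0 ≤ h) (k : ℕ) :
    ∑ j ∈ Finset.range k, h / 3 ^ j ≤ 3 / 2 * h := by
  have : ∀ k : ℕ, ∑ j ∈ Finset.range k, h / 3 ^ j = 3 / 2 * h * (1 - 1 / 3 ^ k) := by
    intro k
    induction k with
    | zero => simp
    | succ k ih => rw [Finset.sum_range_succ, ih, pow_succ]; field_simp; ring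
  rw [this]
  have h3 : 0 ≤ 1 / (3 : ℝ) ^ k := by positivity
  nlinarith

lemma aux_convA (S : Finset ℕ) (B : ℝ) (c : ℕ → ℂ)
    (h : ∀ x : ℝ, 7 / 8 ≤ x → x ≤ 13 / 8 →
      ‖∑ n ∈ S, c n * Complex.exp (Complex.I * x * n)‖ ≤ B) :
    ‖∑ n ∈ S, c n * cantorA n‖ ≤ B := by
  have ht : Filter.Tendsto (fun k : ℕ => ‖∑ n ∈ S, c n * Complex.exp (Complex.I * (5 / 4 : ℝ) * n) *
      ((∏ j ∈ Finset.range k, Real.cos (n * (1 / 4 / 3 ^ j)) : ℝ) : ℂ)‖) Filter.atTop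
      (nhds ‖∑ n ∈ S, c n * cantorA n‖) := by
    refine Filter.Tendsto.norm ?_
    refine tendsto_finsetSum _ (fun n _ => ?_)
    unfold cantorA
    rw [← mul_assoc]
    push_cast
    refine Filter.Tendsto.const_mul _ ?_
    have := (Complex.continuous_ofReal.tendsto _).comp (aux_tendsto n)
    refine this.congr (fun k => ?_)
    simp
  refine le_of_tendsto ht (Filter.Eventually.of_forall (fun k => ?_))
  refine aux_conv S B (fun j => 1 / 4 / 3 ^ j) (fun j => by positivity) k _ c (fun x hx => ?_)
  have := hx.trans (aux_geom_window (1 / 4) (by norm_num) k)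
  rw [abs_le] at this
  exact h x (by linarith) (by linarith)

lemma aux_exp_lower (x : ℝ) (hx : |x| ≤ 3) : 2 / π * |x| ≤ ‖Complex.exp (Complex.I * x) - 1‖ := by
  rw [Complex.norm_exp_I_mul_ofReal_sub_one, norm_mul, Real.norm_eq_abs, Real.norm_eq_abs]
  have h1 : |Real.sin (x / 2)| = Real.sin (|x| / 2) := by
    rcases abs_cases x with ⟨h, h0⟩ | ⟨h, h0⟩
    · rw [h, abs_of_nonneg]
      apply Real.sin_nonneg_of_nonneg_of_le_pi <;> linarith [Real.pi_gt_three]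
    · rw [h, neg_div, Real.sin_neg, abs_of_nonpos]
      apply Real.sin_nonpos_of_nonpos_of_neg_pi_le <;> linarith [Real.pi_gt_three]
  have h2 := Real.mul_le_sin (x := |x| / 2) (by positivity) (by linarith [Real.pi_gt_three])
  rw [h1, abs_of_pos (by norm_num : (0 : ℝ) < 2)]
  linarith

lemma aux_geom (N : ℕ) (x : ℝ) (hx0 : x ≠ 0) (hx : |x| ≤ 3) :
    ‖∑ n ∈ Finset.range N, Complex.exp (Complex.I * x * n)‖ ≤ π / |x| := by
  have hl := aux_exp_lower x hx
  have hp : 0 < |x| := abs_pos.mpr hx0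
  have hpi := Real.pi_pos
  have hne : 0 < ‖Complex.exp (Complex.I * x) - 1‖ := lt_of_lt_of_le (by positivity) hl
  have h1 : Complex.exp (Complex.I * x) ≠ 1 := fun h => by simp [h] at hne
  have : ∑ n ∈ Finset.range N, Complex.exp (Complex.I * x * n) =
      ∑ n ∈ Finset.range N, (Complex.exp (Complex.I * x)) ^ n := by
    refine Finset.sum_congr rfl (fun n _ => ?_)
    rw [← Complex.exp_nat_mul, mul_comm]
  rw [this, geom_sum_eq h1, norm_div, ← Complex.exp_nat_mul]
  have h2 : ‖Complex.exp (N * (Complex.I * x)) - 1‖ ≤ 2 := by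
    refine (norm_sub_le _ _).trans ?_
    rw [show (N : ℂ) * (Complex.I * x) = ((N * x : ℝ) : ℂ) * Complex.I by push_cast; ring,
      Complex.norm_exp_ofReal_mul_I]
    norm_num
  rw [div_le_div_iff₀ hne hp]
  calc _ ≤ 2 * |x| := by gcongr
    _ = π * (2 / π * |x|) := by field_simp
    _ ≤ _ := by gcongr

lemma aux_E1 (N m : ℕ) (h y : ℝ) (hh : 0 < h) (hy : 3 * h < |y|) (hy3 : |y| + 3 * h ≤ 3) :
    ‖∑ n ∈ Finset.range N, Complex.exp (Complex.I * y * n) *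
      ((∏ j ∈ Finset.range m, Real.cos (n * (h / 3 ^ j)) ^ 2 : ℝ) : ℂ)‖ ≤ π / (|y| - 3 * h) := by
  set u : ℕ → ℝ := fun j => h / 3 ^ j with hu
  have hu0 : ∀ j, 0 ≤ u j := fun j => by positivity
  have hw := aux_geom_window h hh.le m
  have := aux_conv (Finset.range N) (π / (|y| - 3 * h)) u hu0 m y
    (fun n => ((∏ j ∈ Finset.range m, Real.cos (n * u j) : ℝ) : ℂ)) (by
      intro x hx
      have h2 := aux_conv (Finset.range N) (π / (|y| - 3 * h)) u hu0 m x (fun n => 1) (by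
        intro x' hx'
        simp only [one_mul]
        have e1 := abs_sub_abs_le_abs_sub x' y
        have e2 := abs_sub_abs_le_abs_sub y x'
        rw [abs_sub_comm] at e2
        have e3 := abs_sub_le x' x y
        have hp : 0 < |x'| := by linarith
        refine (aux_geom N x' (abs_pos.mp hp) (by linarith)).trans ?_
        have := Real.pi_pos
        gcongr
        linarith)
      refine le_trans (le_of_eq ?_) h2
      congr 1
      refine Finset.sum_congr rfl (fun n _ => by ring))
  refine le_trans (le_of_eq ?_) this
  congr 1
  refine Finset.sum_congr rfl (fun n _ => ?_)
  rw [Finset.prod_pow]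
  simp only [hu]
  push_cast
  ring

lemma aux_E0 (N : ℕ) : ∀ (m : ℕ) (h : ℝ), 0 < h → h ≤ 1 →
    ∑ n ∈ Finset.range N, ∏ j ∈ Finset.range m, Real.cos (n * (h / 3 ^ j)) ^ 2 ≤
      N / 2 ^ m + π / h * ((3 / 2) ^ m - 1) := by
  intro m
  induction m with
  | zero => intro h _ _; simp
  | succ m ih =>
    intro h h0 h1
    have i0 := ih (h / 3) (by positivity) (by linarith)
    have key : ∀ y : ℝ, |y| = 2 * h → ‖∑ n ∈ Finset.range N, Complex.exp (Complex.I * y * n) *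
      ((∏ j ∈ Finset.range m, Real.cos (n * (h / 3 / 3 ^ j)) ^ 2 : ℝ) : ℂ)‖ ≤ π / h := by
      intro y hy
      refine (aux_E1 N m (h / 3) y (by positivity) (by rw [hy]; linarith)
        (by rw [hy]; linarith)).trans (le_of_eq ?_)
      rw [hy]; congr 1; ring
    have k1 := key (2 * h) (abs_of_pos (by positivity))
    have hre : ∑ n ∈ Finset.range N, ∏ j ∈ Finset.range (m + 1), Real.cos (n * (h / 3 ^ j)) ^ 2 =
      1 / 2 * (∑ n ∈ Finset.range N, ∏ j ∈ Finset.range m, Real.cos (n * (h / 3 / 3 ^ j)) ^ 2) +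
      1 / 2 * (∑ n ∈ Finset.range N, Complex.exp (Complex.I * (2 * h : ℝ) * n) *
        ((∏ j ∈ Finset.range m, Real.cos (n * (h / 3 / 3 ^ j)) ^ 2 : ℝ) : ℂ)).re := by
      rw [Complex.re_sum, Finset.mul_sum, Finset.mul_sum, ← Finset.sum_add_distrib]
      refine Finset.sum_congr rfl (fun n _ => ?_)
      rw [Finset.prod_range_succ']
      have : ∏ j ∈ Finset.range m, Real.cos (n * (h / 3 ^ (j + 1))) ^ 2 =
          ∏ j ∈ Finset.range m, Real.cos (n * (h / 3 / 3 ^ j)) ^ 2 := by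
        refine Finset.prod_congr rfl (fun j _ => ?_)
        congr 3
        rw [pow_succ]; field_simp
      rw [this]
      generalize (∏ j ∈ Finset.range m, Real.cos (n * (h / 3 / 3 ^ j)) ^ 2) = P
      rw [Complex.re_mul_ofReal, show Complex.I * ((2 * h : ℝ) : ℂ) * n = ((2 * (n * h) : ℝ) : ℂ) * Complex.I
        by push_cast; ring, Complex.exp_ofReal_mul_I_re, Real.cos_two_mul]
      simp
      ring
    rw [hre]
    have := (Complex.re_le_norm _).trans k1
    have e : (N : ℝ) / 2 ^ (m + 1) + π / h * ((3 / 2) ^ (m + 1) - 1) =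
      1 / 2 * (N / 2 ^ m + π / (h / 3) * ((3 / 2) ^ m - 1)) + 1 / 2 * (π / h) := by
      rw [pow_succ, pow_succ]; field_simp; ring
    rw [e]
    linarith

lemma aux_r_sq_le (n m : ℕ) :
    cantorR n ^ 2 ≤ ∏ j ∈ Finset.range m, Real.cos (n * (1 / 4 / 3 ^ j)) ^ 2 := by
  have ht := (aux_tendsto n).pow 2
  refine le_of_tendsto ht ?_
  filter_upwards [Filter.eventually_ge_atTop m] with k hk
  rw [← Finset.prod_pow, ← Finset.prod_range_mul_prod_Ico _ hk]
  refine mul_le_of_le_one_right (Finset.prod_nonneg fun _ _ => sq_nonneg _) ?_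
  exact Finset.prod_le_one (fun _ _ => sq_nonneg _) (fun _ _ => Real.cos_sq_le_one _)

lemma aux_r_sq_le_one (n : ℕ) : cantorR n ^ 2 ≤ 1 := by
  simpa using aux_r_sq_le n 0

lemma aux_S (m : ℕ) : ∑ n ∈ Finset.range (3 ^ m), cantorR n ^ 2 ≤ 17 * (3 / 2) ^ m := by
  have h1 := aux_E0 (3 ^ m) m (1 / 4) (by norm_num) (by norm_num)
  have h2 : ∑ n ∈ Finset.range (3 ^ m), cantorR n ^ 2 ≤ _ :=
    Finset.sum_le_sum (fun n _ => aux_r_sq_le n m)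
  refine (h2.trans h1).trans ?_
  push_cast
  rw [← div_pow]
  have hp : (0 : ℝ) < (3 / 2) ^ m := by positivity
  have := Real.pi_pos
  have := Real.pi_lt_four
  have : π / (1 / 4) * ((3 / 2) ^ m - 1) ≤ 16 * (3 / 2) ^ m := by nlinarith
  linarith

lemma aux_lip (s : ℂ) (hs : 0 < s.re) (p q : ℝ) (hp : 1 ≤ p) (hq : 1 ≤ q) :
    ‖(p : ℂ) ^ (-s) - (q : ℂ) ^ (-s)‖ ≤ ‖s‖ * |p - q| := by
  have := Convex.norm_image_sub_le_of_norm_hasDerivWithin_le (𝕜 := ℝ)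
    (f := fun y : ℝ => (y : ℂ) ^ (-s)) (f' := fun y : ℝ => (-s) * (y : ℂ) ^ (-s - 1))
    (s := Set.Ici (1 : ℝ)) (C := ‖s‖) (x := q) (y := p) ?_ ?_ (convex_Ici 1) hq hp
  · simpa [Real.norm_eq_abs] using this
  · intro y hy
    have hy1 : (1 : ℝ) ≤ y := hy
    have h1 : HasDerivAt (fun z : ℂ => z ^ (-s)) ((-s) * (y : ℂ) ^ (-s - 1)) (y : ℂ) := by
      have := (hasDerivAt_id (y : ℂ)).cpow_const (c := -s) (Or.inl (by simp; linarith))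
      simpa using this
    exact h1.comp_ofReal.hasDerivWithinAt
  · intro y hy
    have hy1 : (1 : ℝ) ≤ y := hy
    rw [norm_mul, norm_neg, Complex.norm_cpow_eq_rpow_re_of_pos (by linarith)]
    refine mul_le_of_le_one_right (norm_nonneg _) ?_
    apply Real.rpow_le_one_of_one_le_of_nonpos hy1
    simp; linarith

lemma aux_tele (g w : ℕ → ℂ) (N M : ℕ) (hNM : N ≤ M) :
    ∑ n ∈ Finset.Ico N M, (g n - g (n + 1)) * w n = g N * w N - g M * w M +
      ∑ n ∈ Finset.Ico N M, g (n + 1) * (w (n + 1) - w n) := by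
  induction M, hNM using Nat.le_induction with
  | base => simp
  | succ M h ih =>
    rw [Finset.sum_Ico_succ_top h, Finset.sum_Ico_succ_top h, ih]
    ring

lemma aux_tele_inv (N M : ℕ) (hNM : N ≤ M) :
    ∑ n ∈ Finset.Ico N M, (1 / (n : ℝ) - 1 / ((n + 1 : ℕ) : ℝ)) = 1 / (N : ℝ) - 1 / (M : ℝ) := by
  induction M, hNM using Nat.le_induction with
  | base => simp
  | succ M h ih =>
    rw [Finset.sum_Ico_succ_top h, ih]
    ring

lemma aux_tail_x (s : ℂ) (hs : 0 < s.re) (N M : ℕ) (hN : 1 ≤ N) (hNs : 4 * ‖s‖ ≤ N)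
    (hNM : N ≤ M) (x : ℝ) (hx1 : 7 / 8 ≤ x) (hx2 : x ≤ 13 / 8) :
    ‖∑ n ∈ Finset.Ico N M, ((n : ℕ) : ℂ) ^ (-s) * Complex.exp (Complex.I * x * n)‖ ≤
      12 * (N : ℝ) ^ (-s.re) := by
  set g : ℕ → ℂ := fun n => ((n : ℕ) : ℂ) ^ (-s) * Complex.exp (Complex.I * x * n) with hg
  set p : ℕ → ℝ := fun n => 1 + 1 / (n : ℝ) with hp
  set ρ : ℕ → ℂ := fun n => Complex.exp (Complex.I * x) * ((p n : ℝ) : ℂ) ^ (-s) with hρ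
  set w : ℕ → ℂ := fun n => 1 / (1 - ρ n) with hw
  have hp1 : ∀ n, 1 ≤ p n := fun n => by
    have : (0 : ℝ) ≤ 1 / (n : ℝ) := by positivity
    simp only [hp]; linarith
  have hex : ‖Complex.exp (Complex.I * x)‖ = 1 := by
    rw [mul_comm, Complex.norm_exp_ofReal_mul_I]
  have hNpos : (0 : ℝ) < N := by exact_mod_cast hN
  have hlow : ∀ n, N ≤ n → 1 / 4 ≤ ‖1 - ρ n‖ := by
    intro n hn
    have hnN : (N : ℝ) ≤ n := by exact_mod_cast hn
    have h1 := aux_exp_lower x (by rw [abs_of_pos] <;> linarith)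
    rw [abs_of_pos (by linarith)] at h1
    have h2 : 1 / 2 ≤ 2 / π * x := by
      have := Real.pi_lt_d2
      have := Real.pi_pos
      rw [div_mul_eq_mul_div, le_div_iff₀ this]
      linarith
    have h3 : ‖ρ n - Complex.exp (Complex.I * x)‖ ≤ 1 / 4 := by
      have : ρ n - Complex.exp (Complex.I * x) =
        Complex.exp (Complex.I * x) * (((p n : ℝ) : ℂ) ^ (-s) - ((1 : ℝ) : ℂ) ^ (-s)) := by
        simp only [hρ]; simp; ring
      rw [this, norm_mul, hex, one_mul]
      refine (aux_lip s hs _ _ (hp1 n) le_rfl).trans ?_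
      have : p n - 1 = 1 / (n : ℝ) := by simp only [hp]; ring
      rw [this, abs_of_nonneg (by positivity), mul_one_div, div_le_iff₀ (by linarith)]
      linarith
    have h4 : ‖Complex.exp (Complex.I * x) - 1‖ ≤ ‖1 - ρ n‖ + ‖ρ n - Complex.exp (Complex.I * x)‖ := by
      have := norm_add_le (1 - ρ n) (ρ n - Complex.exp (Complex.I * x))
      rw [← norm_neg (Complex.exp (Complex.I * x) - 1)]
      refine le_trans (le_of_eq ?_) this
      congr 1; ring
    linarith
  have hne : ∀ n, N ≤ n → 1 - ρ n ≠ 0 := fun n hn h => by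
    have := hlow n hn
    rw [h, norm_zero] at this; norm_num at this
  have hwb : ∀ n, N ≤ n → ‖w n‖ ≤ 4 := by
    intro n hn
    simp only [hw]
    rw [norm_div, norm_one, div_le_iff₀ (norm_pos_iff.mpr (hne n hn))]
    linarith [hlow n hn]
  have hgs : ∀ n, N ≤ n → g (n + 1) = g n * ρ n := by
    intro n hn
    have hn0 : (0 : ℝ) < n := by exact_mod_cast (lt_of_lt_of_le hN hn)
    have : ((n + 1 : ℕ) : ℂ) = ((n : ℝ) : ℂ) * ((p n : ℝ) : ℂ) := by
      rw [← Complex.ofReal_mul]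
      simp only [hp]
      rw [mul_add, mul_one, mul_one_div_cancel hn0.ne']
      push_cast; ring
    simp only [hg, hρ]
    rw [show Complex.I * x * ((n + 1 : ℕ) : ℂ) = Complex.I * x * n + Complex.I * x by
      push_cast; ring, Complex.exp_add]
    rw [this, Complex.mul_cpow_ofReal_nonneg hn0.le (by linarith [hp1 n])]
    rw [show ((n : ℝ) : ℂ) = (n : ℂ) by simp]
    ring
  have hgn : ∀ n, N ≤ n → ‖g n‖ ≤ (N : ℝ) ^ (-s.re) := by
    intro n hn
    have hn0 : 0 < n := lt_of_lt_of_le hN hn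
    have hnN : (N : ℝ) ≤ n := by exact_mod_cast hn
    simp only [hg]
    rw [norm_mul, show Complex.I * x * n = ((x * n : ℝ) : ℂ) * Complex.I by push_cast; ring,
      Complex.norm_exp_ofReal_mul_I, mul_one, Complex.norm_natCast_cpow_of_pos hn0]
    rw [Complex.neg_re]
    exact Real.rpow_le_rpow_of_nonpos hNpos hnN (by linarith)
  have hsum : ∑ n ∈ Finset.Ico N M, g n = ∑ n ∈ Finset.Ico N M, (g n - g (n + 1)) * w n := by
    refine Finset.sum_congr rfl (fun n hn => ?_)
    have hn' := (Finset.mem_Ico.mp hn).1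
    rw [hgs n hn']
    simp only [hw]
    have := hne n hn'
    field_simp
  have hdw : ∀ n, N ≤ n → ‖w (n + 1) - w n‖ ≤ 16 * ‖s‖ * (1 / (n : ℝ) - 1 / ((n + 1 : ℕ) : ℝ)) := by
    intro n hn
    have e : w (n + 1) - w n = w (n + 1) * w n * (ρ (n + 1) - ρ n) := by
      simp only [hw]
      have h1 := hne n hn
      have h2 := hne (n + 1) (by omega)
      field_simp
      ring
    have hn0 : (0 : ℝ) < n := by exact_mod_cast (lt_of_lt_of_le hN hn)
    have h3 : ‖ρ (n + 1) - ρ n‖ ≤ ‖s‖ * (1 / (n : ℝ) - 1 / ((n + 1 : ℕ) : ℝ)) := by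
      simp only [hρ]
      rw [← mul_sub, norm_mul, hex, one_mul]
      refine (aux_lip s hs _ _ (hp1 _) (hp1 _)).trans (le_of_eq ?_)
      congr 1
      simp only [hp]
      rw [abs_sub_comm, abs_of_nonneg]
      · ring
      · have : 1 / ((n + 1 : ℕ) : ℝ) ≤ 1 / (n : ℝ) := by
          apply one_div_le_one_div_of_le hn0
          push_cast; linarith
        linarith
    rw [e, norm_mul, norm_mul]
    calc _ ≤ 4 * 4 * (‖s‖ * (1 / (n : ℝ) - 1 / ((n + 1 : ℕ) : ℝ))) := by
          gcongr
          · exact hwb _ (by omega)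
          · exact hwb _ hn
      _ = _ := by ring
  rw [hsum, aux_tele g w N M hNM]
  have hR : 0 ≤ (N : ℝ) ^ (-s.re) := by positivity
  have b1 : ‖g N * w N‖ ≤ (N : ℝ) ^ (-s.re) * 4 := by
    rw [norm_mul]; exact mul_le_mul (hgn N le_rfl) (hwb N le_rfl) (norm_nonneg _) hR
  have b2 : ‖g M * w M‖ ≤ (N : ℝ) ^ (-s.re) * 4 := by
    rw [norm_mul]; exact mul_le_mul (hgn M hNM) (hwb M hNM) (norm_nonneg _) hR
  have b3 : ‖∑ n ∈ Finset.Ico N M, g (n + 1) * (w (n + 1) - w n)‖ ≤ (N : ℝ) ^ (-s.re) * 4 := by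
    calc _ ≤ ∑ n ∈ Finset.Ico N M, (N : ℝ) ^ (-s.re) *
          (16 * ‖s‖ * (1 / (n : ℝ) - 1 / ((n + 1 : ℕ) : ℝ))) := by
          refine norm_sum_le_of_le _ (fun n hn => ?_)
          have hn' := (Finset.mem_Ico.mp hn).1
          rw [norm_mul]
          exact mul_le_mul (hgn _ (by omega)) (hdw n hn') (norm_nonneg _) hR
      _ = (N : ℝ) ^ (-s.re) * (16 * ‖s‖ * (1 / (N : ℝ) - 1 / (M : ℝ))) := by
          rw [← Finset.mul_sum, ← Finset.mul_sum, aux_tele_inv N M hNM]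
      _ ≤ _ := by
          refine mul_le_mul_of_nonneg_left ?_ hR
          have : 0 ≤ 1 / (M : ℝ) := by positivity
          have h5 : ‖s‖ * (1 / (N : ℝ)) ≤ 1 / 4 := by
            rw [mul_one_div, div_le_iff₀ hNpos]; linarith
          nlinarith [norm_nonneg s]
  have := norm_add_le (g N * w N - g M * w M) (∑ n ∈ Finset.Ico N M, g (n + 1) * (w (n + 1) - w n))
  have := norm_sub_le (g N * w N) (g M * w M)
  linarith

noncomputable def auxD (M : ℕ) (s : ℂ) : ℂ :=
  ∑ n ∈ Finset.range M, cantorA (n + 1) * ((n + 1 : ℕ) : ℂ) ^ (-s)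

lemma aux_tail (s : ℂ) (hs : 0 < s.re) (N M : ℕ) (hNs : 4 * ‖s‖ ≤ (N : ℝ) + 1)
    (hNM : N ≤ M) : ‖auxD M s - auxD N s‖ ≤ 12 * ((N : ℝ) + 1) ^ (-s.re) := by
  have h := aux_convA (Finset.Ico (N + 1) (M + 1)) (12 * ((N : ℝ) + 1) ^ (-s.re))
    (fun n => ((n : ℕ) : ℂ) ^ (-s)) (fun x h1 h2 => by
      have := aux_tail_x s hs (N + 1) (M + 1) (by omega) (by push_cast; exact hNs) (by omega) x h1 h2
      push_cast at this
      exact this)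
  refine le_trans (le_of_eq ?_) h
  congr 1
  unfold auxD
  rw [← Finset.sum_Ico_eq_sub _ hNM, ← Finset.sum_Ico_add']
  refine Finset.sum_congr rfl (fun n _ => by ring)

lemma aux_A_norm (n : ℕ) : ‖cantorA n‖ = |cantorR n| := by
  unfold cantorA
  rw [norm_mul, show Complex.I * (5 / 4) * n = ((5 / 4 * n : ℝ) : ℂ) * Complex.I by push_cast; ring,
      Complex.norm_exp_ofReal_mul_I, one_mul, Complex.norm_real, Real.norm_eq_abs]

lemma aux_D_tendsto (s : ℂ) (hs : 1 < s.re) :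
    Filter.Tendsto (fun M => auxD M s) Filter.atTop (nhds (cantorSeries s)) := by
  have : Summable (fun n : ℕ => cantorA (n + 1) * ((n + 1 : ℕ) : ℂ) ^ (-s)) := by
    have h1 : Summable (fun n : ℕ => ((n + 1 : ℕ) : ℝ) ^ (-s.re)) :=
      (summable_nat_add_iff 1).mpr (Real.summable_nat_rpow.mpr (by linarith))
    refine Summable.of_norm_bounded h1 (fun n => ?_)
    rw [norm_mul, Complex.norm_natCast_cpow_of_pos (by omega), Complex.neg_re, aux_A_norm]
    refine mul_le_of_le_one_left (by positivity) ?_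
    exact (sq_le_one_iff_abs_le_one _).mp (aux_r_sq_le_one _)
  exact this.hasSum.tendsto_sum_nat

lemma aux_pow_tendsto (a : ℝ) (ha : 0 < a) :
    Filter.Tendsto (fun N : ℕ => 12 * ((N : ℝ) + 1) ^ (-a)) Filter.atTop (nhds 0) := by
  have h1 := (tendsto_rpow_neg_atTop ha).comp
    (Filter.tendsto_atTop_add_const_right _ (1 : ℝ) tendsto_natCast_atTop_atTop)
  have := h1.const_mul (12 : ℝ)
  simpa using this

lemma aux_approx (L : ℂ → ℂ) (hL : Differentiable ℂ L)
    (hLeq : ∀ s : ℂ, 1 < s.re → L s = cantorSeries s) (s : ℂ) (hs : 0 < s.re) (N : ℕ)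
    (hNs : 4 * ‖s‖ ≤ (N : ℝ) + 1) : ‖L s - auxD N s‖ ≤ 12 * ((N : ℝ) + 1) ^ (-s.re) := by
  have hlim : ∀ s : ℂ, 0 < s.re → ∃ z, Filter.Tendsto (fun M => auxD M s) Filter.atTop (nhds z) := by
    intro s hs
    apply cauchySeq_tendsto_of_complete
    rw [Metric.cauchySeq_iff']
    intro ε hε
    have h1 := (aux_pow_tendsto s.re hs).eventually (gt_mem_nhds hε)
    have h2 := Filter.eventually_ge_atTop (⌈4 * ‖s‖⌉₊)
    obtain ⟨N, hN1, hN2⟩ := (h1.and h2).exists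
    refine ⟨N, fun n hn => ?_⟩
    rw [dist_eq_norm]
    refine lt_of_le_of_lt (aux_tail s hs N n ?_ hn) hN1
    have : (⌈4 * ‖s‖⌉₊ : ℝ) ≤ N := by exact_mod_cast hN2
    linarith [Nat.le_ceil (4 * ‖s‖)]
  classical
  set G : ℂ → ℂ := fun s => if h : 0 < s.re then (hlim s h).choose else 0 with hG
  have hGt : ∀ s : ℂ, 0 < s.re → Filter.Tendsto (fun M => auxD M s) Filter.atTop (nhds (G s)) := by
    intro s hs
    simp only [hG, hs, dif_pos]
    exact (hlim s hs).choose_spec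
  have hGb : ∀ (s : ℂ) (N : ℕ), 0 < s.re → 4 * ‖s‖ ≤ (N : ℝ) + 1 →
      ‖G s - auxD N s‖ ≤ 12 * ((N : ℝ) + 1) ^ (-s.re) := by
    intro s N hs hN
    have h1 := ((hGt s hs).sub_const (auxD N s)).norm
    refine le_of_tendsto h1 ?_
    filter_upwards [Filter.eventually_ge_atTop N] with M hM
    exact aux_tail s hs N M hN hM
  set U : Set ℂ := {s : ℂ | 0 < s.re} with hU
  have hUo : IsOpen U := isOpen_lt continuous_const Complex.continuous_re
  have hloc : TendstoLocallyUniformlyOn auxD G Filter.atTop U := by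
    rw [Metric.tendstoLocallyUniformlyOn_iff]
    intro ε hε s0 hs0
    have hs0' : 0 < s0.re := hs0
    refine ⟨{s : ℂ | s0.re / 2 < s.re ∧ ‖s‖ < ‖s0‖ + 1}, ?_, ?_⟩
    · apply mem_nhdsWithin_of_mem_nhds
      apply IsOpen.mem_nhds
      · exact (isOpen_lt continuous_const Complex.continuous_re).inter
          (isOpen_lt continuous_norm continuous_const)
      · exact ⟨by linarith, by linarith⟩
    · have h1 := (aux_pow_tendsto (s0.re / 2) (by linarith)).eventually (gt_mem_nhds hε)
      filter_upwards [h1, Filter.eventually_ge_atTop (⌈4 * (‖s0‖ + 1)⌉₊)] with N hN1 hN2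
      intro s hs
      rw [dist_eq_norm]
      have h3 : (⌈4 * (‖s0‖ + 1)⌉₊ : ℝ) ≤ N := by exact_mod_cast hN2
      have h4 := Nat.le_ceil (4 * (‖s0‖ + 1))
      refine lt_of_le_of_lt (hGb s N (by linarith [hs.1]) (by linarith [hs.2])) ?_
      refine lt_of_le_of_lt ?_ hN1
      have : (0 : ℝ) ≤ N := by positivity
      gcongr
      · linarith
      · exact hs.1.le
  have hGd : DifferentiableOn ℂ G U := by
    refine hloc.differentiableOn (Filter.Eventually.of_forall fun M => ?_) hUo
    unfold auxD
    refine DifferentiableOn.fun_sum (fun n _ => ?_)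
    refine DifferentiableOn.const_mul ?_ _
    refine DifferentiableOn.const_cpow differentiableOn_id.neg (Or.inl ?_)
    exact_mod_cast Nat.succ_ne_zero n
  have hEq : Set.EqOn L G U := by
    refine (hL.differentiableOn.analyticOnNhd hUo).eqOn_of_preconnected_of_eventuallyEq
      (hGd.analyticOnNhd hUo) (convex_halfSpace_re_gt 0).isPreconnected
      (z₀ := 2) (by simp [hU]) ?_
    have : {s : ℂ | 1 < s.re} ∈ nhds (2 : ℂ) :=
      (isOpen_lt continuous_const Complex.continuous_re).mem_nhds (by simp)
    filter_upwards [this] with s hs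
    have hs' : 1 < s.re := hs
    rw [hLeq s hs']
    exact tendsto_nhds_unique (aux_D_tendsto s hs') (hGt s (by linarith))
  rw [hEq hs]
  exact hGb s N hs hNs

lemma aux_d_pos : 0 < cantorDim := by
  unfold cantorDim
  exact div_pos (Real.log_pos (by norm_num)) (Real.log_pos (by norm_num))

lemma aux_d_lt : cantorDim < 1 := by
  unfold cantorDim
  rw [div_lt_one (Real.log_pos (by norm_num))]
  exact Real.log_lt_log (by norm_num) (by norm_num)

lemma aux_three_d : (3 : ℝ) ^ cantorDim = 2 := by
  have h3 : (0 : ℝ) < Real.log 3 := Real.log_pos (by norm_num)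
  unfold cantorDim
  rw [Real.rpow_def_of_pos (by norm_num), mul_div_cancel₀ _ h3.ne', Real.exp_log (by norm_num)]

lemma aux_summable : Summable (fun n : ℕ =>
    cantorR (n + 1) ^ 2 * ((n : ℝ) + 1) ^ (-(1 - 3 * cantorDim / 4))) := by
  have hd := aux_d_pos
  have hd1 := aux_d_lt
  set β := 1 - 3 * cantorDim / 4 with hβ
  set f : ℕ → ℝ := fun n => cantorR n ^ 2 * (n : ℝ) ^ (-β) with hf
  set q : ℝ := 3 ^ (-β) * (3 / 2) with hq
  have hq0 : 0 ≤ q := by positivity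
  have hq1 : q < 1 := by
    have : q = 3 ^ (-(cantorDim / 4)) := by
      have h2 : (3 / 2 : ℝ) = 3 ^ (1 - cantorDim) := by
        rw [Real.rpow_sub (by norm_num), Real.rpow_one, aux_three_d]
      rw [hq, h2, ← Real.rpow_add (by norm_num)]
      congr 1
      rw [hβ]; ring
    rw [this]
    exact Real.rpow_lt_one_of_one_lt_of_neg (by norm_num) (by linarith)
  have hf0 : ∀ n, 0 ≤ f n := fun n => by positivity
  have hblock : ∀ K : ℕ, ∑ n ∈ Finset.Ico 1 (3 ^ K), f n ≤ ∑ k ∈ Finset.range K, 51 / 2 * q ^ k := by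
    intro K
    induction K with
    | zero => simp
    | succ K ih =>
      rw [Finset.sum_range_succ, ← Finset.sum_Ico_consecutive f (Nat.one_le_pow K 3 (by norm_num))
        (Nat.pow_le_pow_right (by norm_num) (Nat.le_succ K))]
      refine add_le_add ih ?_
      have hS := aux_S (K + 1)
      calc ∑ n ∈ Finset.Ico (3 ^ K) (3 ^ (K + 1)), f n
          ≤ ∑ n ∈ Finset.Ico (3 ^ K) (3 ^ (K + 1)), cantorR n ^ 2 * (3 ^ (-β)) ^ K := by
            refine Finset.sum_le_sum (fun n hn => ?_)
            have hn' := (Finset.mem_Ico.mp hn).1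
            have hn2 : (3 : ℝ) ^ K ≤ n := by exact_mod_cast hn'
            refine mul_le_mul_of_nonneg_left ?_ (sq_nonneg _)
            rw [← Real.rpow_natCast, ← Real.rpow_mul (by norm_num), mul_comm, Real.rpow_mul (by norm_num),
              Real.rpow_natCast]
            exact Real.rpow_le_rpow_of_nonpos (by positivity) hn2 (by rw [hβ]; linarith)
        _ = (∑ n ∈ Finset.Ico (3 ^ K) (3 ^ (K + 1)), cantorR n ^ 2) * (3 ^ (-β)) ^ K := by
            rw [Finset.sum_mul]
        _ ≤ (17 * (3 / 2) ^ (K + 1)) * (3 ^ (-β)) ^ K := by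
            refine mul_le_mul_of_nonneg_right (le_trans ?_ hS) (by positivity)
            refine Finset.sum_le_sum_of_subset_of_nonneg ?_ (fun _ _ _ => sq_nonneg _)
            intro n hn
            exact Finset.mem_range.mpr (Finset.mem_Ico.mp hn).2
        _ = 51 / 2 * q ^ K := by rw [hq, mul_pow, pow_succ]; ring
  have hgeo := summable_geometric_of_lt_one hq0 hq1
  refine summable_of_sum_range_le (c := ∑' k, 51 / 2 * q ^ k) (fun n => by positivity) (fun M => ?_)
  have e : ∑ n ∈ Finset.range M, cantorR (n + 1) ^ 2 * ((n : ℝ) + 1) ^ (-β) =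
      ∑ n ∈ Finset.Ico 1 (M + 1), f n := by
    rw [Finset.sum_Ico_eq_sum_range]
    refine Finset.sum_congr (by simp) (fun n _ => ?_)
    simp only [hf]
    rw [add_comm 1 n]; push_cast; rfl
  rw [e]
  have hM : M + 1 ≤ 3 ^ (M + 1) := (Nat.lt_pow_self (by norm_num)).le
  calc _ ≤ ∑ n ∈ Finset.Ico 1 (3 ^ (M + 1)), f n :=
        Finset.sum_le_sum_of_subset_of_nonneg (Finset.Ico_subset_Ico_right hM) (fun n _ _ => hf0 n)
    _ ≤ _ := hblock (M + 1)
    _ ≤ _ := (hgeo.mul_left _).sum_le_tsum _ (fun _ _ => by positivity)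

lemma aux_mv (b : ℕ → ℂ) (l : ℕ → ℝ) (hl : ∀ m n, m ≠ n → l m ≠ l n) (N : ℕ) (T : ℝ) :
    |(∫ t in T..(2 * T), ‖∑ n ∈ Finset.range N, b n * Complex.exp (-(l n * t : ℝ) * Complex.I)‖ ^ 2) -
      (∑ n ∈ Finset.range N, ‖b n‖ ^ 2) * T| ≤
    ∑ m ∈ Finset.range N, ∑ n ∈ Finset.range N,
      if m = n then 0 else ‖b m‖ * ‖b n‖ * (2 / |l m - l n|) := by
  have hexp : ∀ t : ℝ, ((‖∑ n ∈ Finset.range N, b n * Complex.exp (-(l n * t : ℝ) * Complex.I)‖ ^ 2 : ℝ) : ℂ)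
      = ∑ m ∈ Finset.range N, ∑ n ∈ Finset.range N, (b m * (starRingEnd ℂ) (b n)) *
        Complex.exp (((l n - l m : ℝ) * Complex.I) * t) := by
    intro t
    rw [Complex.ofReal_pow, ← Complex.mul_conj', map_sum, Finset.sum_mul_sum]
    refine Finset.sum_congr rfl (fun m _ => Finset.sum_congr rfl (fun n _ => ?_))
    rw [map_mul, ← Complex.exp_conj, map_mul, map_neg, Complex.conj_ofReal, Complex.conj_I]
    rw [show b m * Complex.exp (-(l m * t : ℝ) * Complex.I) *
      ((starRingEnd ℂ) (b n) * Complex.exp (-(l n * t : ℝ) * -Complex.I)) =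
      b m * (starRingEnd ℂ) (b n) * (Complex.exp (-(l m * t : ℝ) * Complex.I) *
        Complex.exp (-(l n * t : ℝ) * -Complex.I)) by ring, ← Complex.exp_add]
    congr 2
    push_cast
    ring
  have hfull : (((∫ t in T..(2 * T), ‖∑ n ∈ Finset.range N, b n * Complex.exp (-(l n * t : ℝ) * Complex.I)‖ ^ 2)
      : ℝ) : ℂ) = ∑ m ∈ Finset.range N, ∑ n ∈ Finset.range N, (b m * (starRingEnd ℂ) (b n)) *
        ∫ t in T..(2 * T), Complex.exp (((l n - l m : ℝ) * Complex.I) * t) := by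
    rw [← intervalIntegral.integral_ofReal]
    simp_rw [hexp]
    rw [intervalIntegral.integral_finsetSum]
    · refine Finset.sum_congr rfl (fun m _ => ?_)
      rw [intervalIntegral.integral_finsetSum]
      · refine Finset.sum_congr rfl (fun n _ => ?_)
        rw [intervalIntegral.integral_const_mul]
      · intro n _
        exact Continuous.intervalIntegrable (by fun_prop) _ _
    · intro m _
      exact Continuous.intervalIntegrable (by fun_prop) _ _
  have hdiag : (((∑ n ∈ Finset.range N, ‖b n‖ ^ 2) * T : ℝ) : ℂ) =
      ∑ m ∈ Finset.range N, ∑ n ∈ Finset.range N,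
        if m = n then (b m * (starRingEnd ℂ) (b n)) * (T : ℂ) else 0 := by
    push_cast
    rw [Finset.sum_mul]
    refine Finset.sum_congr rfl (fun m hm => ?_)
    rw [Finset.sum_ite_eq, if_pos hm, Complex.mul_conj']
  rw [← Real.norm_eq_abs, ← Complex.norm_real, Complex.ofReal_sub, hfull, hdiag,
    ← Finset.sum_sub_distrib]
  refine norm_sum_le_of_le _ (fun m _ => ?_)
  rw [← Finset.sum_sub_distrib]
  refine norm_sum_le_of_le _ (fun n _ => ?_)
  by_cases hmn : m = n
  · subst hmn
    simp
    ring
  · rw [if_neg hmn, if_neg hmn, sub_zero, norm_mul, norm_mul, RCLike.norm_conj]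
    refine mul_le_mul_of_nonneg_left ?_ (by positivity)
    have hne : ((l n - l m : ℝ) : ℂ) * Complex.I ≠ 0 := by
      refine mul_ne_zero ?_ Complex.I_ne_zero
      exact_mod_cast sub_ne_zero.mpr (hl n m (Ne.symm hmn))
    rw [integral_exp_mul_complex hne, norm_div, norm_mul, Complex.norm_I, mul_one, Complex.norm_real,
      Real.norm_eq_abs, abs_sub_comm]
    refine div_le_div_of_nonneg_right ?_ (abs_nonneg _)
    have hn1 : ∀ t : ℝ, ‖Complex.exp (((l n - l m : ℝ) * Complex.I) * t)‖ = 1 := by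
      intro t
      rw [show ((l n - l m : ℝ) : ℂ) * Complex.I * t = (((l n - l m) * t : ℝ) : ℂ) * Complex.I by
        push_cast; ring, Complex.norm_exp_ofReal_mul_I]
    refine (norm_sub_le _ _).trans ?_
    rw [hn1, hn1]; norm_num

lemma aux_log_ineq_lt (p q : ℝ) (hq : 0 < q) (hpq : q < p) :
    1 / (√p * √q) * (1 / |Real.log p - Real.log q|) ≤ 1 / |p - q| + 1 / (√p * √q) := by
  have hp : 0 < p := hq.trans hpq
  have h1 := Real.one_sub_inv_le_log_of_pos (div_pos hp hq)
  rw [Real.log_div hp.ne' hq.ne', inv_div] at h1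
  have h2 : 0 < (p - q) / p := div_pos (by linarith) hp
  have h3 : (p - q) / p ≤ Real.log p - Real.log q := by
    rw [sub_div, div_self hp.ne']; exact h1
  rw [abs_of_pos (by linarith), abs_of_pos (by linarith)]
  have h4 : q ≤ √p * √q := by
    rw [← Real.sqrt_mul hp.le]
    apply Real.le_sqrt_of_sq_le
    nlinarith
  have h5 : 0 < √p * √q := by positivity
  have h6 : 0 < p - q := by linarith
  calc _ ≤ 1 / (√p * √q) * (1 / ((p - q) / p)) := by gcongr
    _ = p / (√p * √q) / (p - q) := by field_simp
    _ ≤ (√p * √q + (p - q)) / (√p * √q) / (p - q) := by gcongr; linarith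
    _ = _ := by
      generalize √p * √q = z at h5
      field_simp

lemma aux_log_ineq (p q : ℝ) (hp : 0 < p) (hq : 0 < q) (hpq : p ≠ q) :
    1 / (√p * √q) * (1 / |Real.log p - Real.log q|) ≤ 1 / |p - q| + 1 / (√p * √q) := by
  rcases lt_or_gt_of_ne hpq with h | h
  · have := aux_log_ineq_lt q p hp h
    rwa [mul_comm √q, abs_sub_comm (Real.log q), abs_sub_comm q] at this
  · exact aux_log_ineq_lt p q hq h

lemma aux_H_mono {a b : ℕ} (h : a ≤ b) : ∑ i ∈ Finset.range a, 1 / ((i : ℝ) + 1) ≤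
    ∑ i ∈ Finset.range b, 1 / ((i : ℝ) + 1) := by
  refine Finset.sum_le_sum_of_subset_of_nonneg (Finset.range_mono h) (fun i _ _ => by positivity)

lemma aux_H (N n : ℕ) (hn : n < N) :
    ∑ m ∈ Finset.range N, (if m = n then 0 else 1 / |(m : ℝ) - n|) ≤
      2 * ∑ i ∈ Finset.range N, 1 / ((i : ℝ) + 1) := by
  rw [← Finset.sum_range_add_sum_Ico _ (Nat.succ_le_of_lt hn), Finset.sum_range_succ, if_pos rfl,
    add_zero, ← Finset.sum_range_reflect, Finset.sum_Ico_eq_sum_range, two_mul]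
  refine add_le_add ?_ ?_
  · refine le_trans (le_of_eq ?_) (aux_H_mono hn.le)
    refine Finset.sum_congr rfl (fun i hi => ?_)
    have hi' := Finset.mem_range.mp hi
    rw [if_neg (by omega)]
    congr 1
    have : ((n - 1 - i : ℕ) : ℝ) = n - 1 - i := by
      rw [Nat.cast_sub (by omega), Nat.cast_sub (by omega)]; simp
    rw [this, abs_sub_comm, abs_of_nonneg]
    · ring
    · have : (0 : ℝ) ≤ i := by positivity
      linarith
  · refine le_trans (le_of_eq ?_) (aux_H_mono (Nat.sub_le N (n + 1)))
    refine Finset.sum_congr rfl (fun i hi => ?_)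
    rw [if_neg (by omega)]
    congr 1
    push_cast
    rw [abs_of_nonneg]
    · ring
    · have : (0 : ℝ) ≤ i := by positivity
      linarith

lemma aux_off (r : ℕ → ℝ) (N : ℕ) :
    ∑ m ∈ Finset.range N, ∑ n ∈ Finset.range N,
      (if m = n then 0 else (|r m| / √((m : ℝ) + 1)) * (|r n| / √((n : ℝ) + 1)) *
        (2 / |Real.log ((m : ℝ) + 1) - Real.log ((n : ℝ) + 1)|)) ≤
    6 * ((∑ n ∈ Finset.range N, r n ^ 2) * ∑ i ∈ Finset.range N, 1 / ((i : ℝ) + 1)) := by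
  set H := ∑ i ∈ Finset.range N, 1 / ((i : ℝ) + 1) with hH
  set κ : ℕ → ℕ → ℝ := fun m n => if m = n then 0 else 1 / |(m : ℝ) - n| with hκ
  have hκs : ∀ m n, κ m n = κ n m := by
    intro m n
    simp only [hκ, eq_comm (a := m), abs_sub_comm (m : ℝ)]
  have hκ0 : ∀ m n, 0 ≤ κ m n := by
    intro m n
    simp only [hκ]; split_ifs <;> positivity
  have h1 : ∀ m n : ℕ, (if m = n then 0 else (|r m| / √((m : ℝ) + 1)) * (|r n| / √((n : ℝ) + 1)) *
        (2 / |Real.log ((m : ℝ) + 1) - Real.log ((n : ℝ) + 1)|)) ≤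
      r m ^ 2 * κ m n + r n ^ 2 * κ m n + 2 * ((|r m| / √((m : ℝ) + 1)) * (|r n| / √((n : ℝ) + 1))) := by
    intro m n
    by_cases hmn : m = n
    · rw [if_pos hmn]
      have := hκ0 m n
      positivity
    · have hmn' : (m : ℝ) + 1 ≠ n + 1 := by
        intro h; apply hmn; exact_mod_cast (add_right_cancel h)
      have := aux_log_ineq ((m : ℝ) + 1) ((n : ℝ) + 1) (by positivity) (by positivity) hmn'
      rw [show (m : ℝ) + 1 - (n + 1) = m - n by ring] at this
      have hk : κ m n = 1 / |(m : ℝ) - n| := by simp only [hκ, if_neg hmn]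
      rw [← hk] at this
      rw [if_neg hmn]
      have hrr : 0 ≤ |r m| * |r n| := by positivity
      have h2 := mul_le_mul_of_nonneg_left this hrr
      have h3 : 2 * (|r m| * |r n|) * κ m n ≤ (r m ^ 2 + r n ^ 2) * κ m n := by
        refine mul_le_mul_of_nonneg_right ?_ (hκ0 m n)
        nlinarith [sq_nonneg (|r m| - |r n|), sq_abs (r m), sq_abs (r n)]
      have e1 : (|r m| / √((m : ℝ) + 1)) * (|r n| / √((n : ℝ) + 1)) *
        (2 / |Real.log ((m : ℝ) + 1) - Real.log ((n : ℝ) + 1)|) = 2 * (|r m| * |r n| *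
        (1 / (√((m : ℝ) + 1) * √((n : ℝ) + 1)) * (1 / |Real.log ((m : ℝ) + 1) - Real.log ((n : ℝ) + 1)|))) := by
        rw [div_mul_div_comm]; ring
      have e2 : (|r m| / √((m : ℝ) + 1)) * (|r n| / √((n : ℝ) + 1)) = |r m| * |r n| *
        (1 / (√((m : ℝ) + 1) * √((n : ℝ) + 1))) := by
        rw [div_mul_div_comm]; ring
      rw [e1, e2]
      rw [mul_add] at h2
      linarith
  have hA : ∑ m ∈ Finset.range N, ∑ n ∈ Finset.range N, r m ^ 2 * κ m n ≤
      (∑ n ∈ Finset.range N, r n ^ 2) * (2 * H) := by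
    rw [Finset.sum_mul]
    refine Finset.sum_le_sum (fun m hm => ?_)
    rw [← Finset.mul_sum]
    refine mul_le_mul_of_nonneg_left ?_ (sq_nonneg _)
    simp_rw [hκs m]
    exact aux_H N m (Finset.mem_range.mp hm)
  have hB : ∑ m ∈ Finset.range N, ∑ n ∈ Finset.range N, r n ^ 2 * κ m n ≤
      (∑ n ∈ Finset.range N, r n ^ 2) * (2 * H) := by
    rw [Finset.sum_comm]
    simp_rw [hκs _ _]
    refine le_trans (le_of_eq ?_) hA
    refine Finset.sum_congr rfl (fun m _ => Finset.sum_congr rfl (fun n _ => ?_))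
    rfl
  have hC : ∑ m ∈ Finset.range N, ∑ n ∈ Finset.range N,
      (|r m| / √((m : ℝ) + 1)) * (|r n| / √((n : ℝ) + 1)) ≤ (∑ n ∈ Finset.range N, r n ^ 2) * H := by
    rw [← Finset.sum_mul_sum, ← sq]
    have := Finset.sum_mul_sq_le_sq_mul_sq (Finset.range N) (fun n => |r n|) (fun n => 1 / √((n : ℝ) + 1))
    refine le_trans (le_of_eq ?_) (this.trans (le_of_eq ?_))
    · congr 1
      refine Finset.sum_congr rfl (fun n _ => by ring)
    · congr 1
      · refine Finset.sum_congr rfl (fun n _ => sq_abs _)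
      · refine Finset.sum_congr rfl (fun n _ => ?_)
        rw [div_pow, one_pow, Real.sq_sqrt (by positivity)]
  calc _ ≤ ∑ m ∈ Finset.range N, ∑ n ∈ Finset.range N, (r m ^ 2 * κ m n + r n ^ 2 * κ m n +
        2 * ((|r m| / √((m : ℝ) + 1)) * (|r n| / √((n : ℝ) + 1)))) :=
        Finset.sum_le_sum (fun m _ => Finset.sum_le_sum (fun n _ => h1 m n))
    _ = (∑ m ∈ Finset.range N, ∑ n ∈ Finset.range N, r m ^ 2 * κ m n) +
        (∑ m ∈ Finset.range N, ∑ n ∈ Finset.range N, r n ^ 2 * κ m n) +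
        2 * ∑ m ∈ Finset.range N, ∑ n ∈ Finset.range N,
          (|r m| / √((m : ℝ) + 1)) * (|r n| / √((n : ℝ) + 1)) := by
        simp only [Finset.sum_add_distrib, Finset.mul_sum]
    _ ≤ _ := by linarith

lemma aux_H_le (N : ℕ) (hN : 1 ≤ N) (ε : ℝ) (hε : 0 < ε) :
    ∑ i ∈ Finset.range N, 1 / ((i : ℝ) + 1) ≤ (1 + 1 / ε) * (N : ℝ) ^ ε := by
  have h := harmonic_le_one_add_log N
  have e : ((harmonic N : ℚ) : ℝ) = ∑ i ∈ Finset.range N, 1 / ((i : ℝ) + 1) := by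
    unfold harmonic
    push_cast
    simp
  rw [e] at h
  have hN1 : (1 : ℝ) ≤ N := by exact_mod_cast hN
  have h1 := Real.log_le_rpow_div (x := (N : ℝ)) (by linarith) hε
  have h2 := Real.one_le_rpow hN1 hε.le
  calc _ ≤ _ := h
    _ ≤ (N : ℝ) ^ ε + (N : ℝ) ^ ε / ε := by linarith
    _ = _ := by ring

lemma aux_D_mv (N : ℕ) (T : ℝ) :
    |(∫ t in T..(2 * T), ‖auxD N (1 / 2 + t * Complex.I)‖ ^ 2) -
      (∑ n ∈ Finset.range N, cantorR (n + 1) ^ 2 / ((n : ℝ) + 1)) * T| ≤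
    6 * ((∑ n ∈ Finset.range N, cantorR (n + 1) ^ 2) * ∑ i ∈ Finset.range N, 1 / ((i : ℝ) + 1)) := by
  set b : ℕ → ℂ := fun n => cantorA (n + 1) * ((1 / √((n : ℝ) + 1) : ℝ) : ℂ) with hb
  set l : ℕ → ℝ := fun n => Real.log ((n : ℝ) + 1) with hl
  have hbn : ∀ n, ‖b n‖ = |cantorR (n + 1)| / √((n : ℝ) + 1) := by
    intro n
    simp only [hb]
    rw [norm_mul, aux_A_norm, Complex.norm_real, Real.norm_of_nonneg (by positivity), mul_one_div]
  have hlinj : ∀ m n, m ≠ n → l m ≠ l n := by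
    intro m n hmn h
    have := Real.log_injOn_pos (Set.mem_Ioi.mpr (by positivity)) (Set.mem_Ioi.mpr (by positivity)) h
    apply hmn
    exact_mod_cast (add_right_cancel this)
  have hD : ∀ t : ℝ, auxD N (1 / 2 + t * Complex.I) =
      ∑ n ∈ Finset.range N, b n * Complex.exp (-(l n * t : ℝ) * Complex.I) := by
    intro t
    unfold auxD
    refine Finset.sum_congr rfl (fun n _ => ?_)
    simp only [hb]
    rw [mul_assoc]
    congr 1
    have hn : (0 : ℝ) < (n : ℝ) + 1 := by positivity
    have hc : ((n + 1 : ℕ) : ℂ) = (((n : ℝ) + 1 : ℝ) : ℂ) := by push_cast; rfl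
    rw [hc, neg_add, Complex.cpow_add _ _ (by exact_mod_cast hn.ne')]
    congr 1
    · rw [show (-(1 / 2) : ℂ) = ((-(1 / 2) : ℝ) : ℂ) by push_cast; rfl, ← Complex.ofReal_cpow hn.le,
        Real.rpow_neg hn.le, Real.sqrt_eq_rpow, ← one_div]
    · rw [Complex.cpow_def_of_ne_zero (by exact_mod_cast hn.ne'), ← Complex.ofReal_log hn.le]
      congr 1
      simp only [hl]
      push_cast
      ring
  have h1 := aux_mv b l hlinj N T
  have h2 := aux_off (fun n => cantorR (n + 1)) N
  simp_rw [hD]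
  have e : ∑ n ∈ Finset.range N, cantorR (n + 1) ^ 2 / ((n : ℝ) + 1) =
      ∑ n ∈ Finset.range N, ‖b n‖ ^ 2 := by
    refine Finset.sum_congr rfl (fun n _ => ?_)
    rw [hbn, div_pow, sq_abs, Real.sq_sqrt (by positivity)]
  rw [e]
  refine h1.trans ?_
  simp_rw [hbn]
  exact h2

/-- The second moment of the Cantor Dirichlet series on the critical line is
`C_ν·T + O(T^{1−d/2})`, with no logarithmic factor, where
`C_ν = ∑_{n≥1} r(n)²/n`. -/
theorem cantor_second_moment
    (L : ℂ → ℂ) (hL : Differentiable ℂ L)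
    (hLeq : ∀ s : ℂ, 1 < s.re → L s = cantorSeries s) :
    ∃ K : ℝ, ∀ T : ℝ, 2 ≤ T →
      |(∫ t in T..(2 * T), ‖L (1 / 2 + t * Complex.I)‖ ^ 2) -
          (∑' n : ℕ, (cantorR (n + 1)) ^ 2 / (n + 1 : ℝ)) * T| ≤
        K * T ^ (1 - cantorDim / 2) := by
  have hd := aux_d_pos
  have hd1 := aux_d_lt
  set d := cantorDim with hdd
  have hsum := aux_summable
  rw [← hdd] at hsum
  set β := 1 - 3 * d / 4 with hβ
  set f : ℕ → ℝ := fun n => cantorR (n + 1) ^ 2 * ((n : ℝ) + 1) ^ (-β) with hf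
  have hf0 : ∀ n, 0 ≤ f n := fun n => by positivity
  set B := ∑' n, f n with hB
  have hB0 : 0 ≤ B := tsum_nonneg hf0
  set c : ℕ → ℝ := fun n => cantorR (n + 1) ^ 2 / ((n : ℝ) + 1) with hc
  have hc0 : ∀ n, 0 ≤ c n := fun n => by positivity
  have hcf : ∀ n, c n = f n * ((n : ℝ) + 1) ^ (-(3 * d / 4)) := by
    intro n
    have hn : (0 : ℝ) < (n : ℝ) + 1 := by positivity
    simp only [hc, hf]
    rw [mul_assoc, ← Real.rpow_add hn, show -β + -(3 * d / 4) = -1 by rw [hβ]; ring,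
      Real.rpow_neg_one]
    rfl
  have hcsum : Summable c := by
    refine Summable.of_nonneg_of_le hc0 (fun n => ?_) hsum
    rw [hcf]
    refine mul_le_of_le_one_right (hf0 n) ?_
    exact Real.rpow_le_one_of_one_le_of_nonpos (by linarith [Nat.cast_nonneg (α := ℝ) n]) (by linarith)
  set Cν := ∑' n, c n with hCν
  have hCν0 : 0 ≤ Cν := tsum_nonneg hc0
  set K1 : ℝ := 60 * B * (1 + 1 / (d / 4)) with hK1
  have hK10 : 0 ≤ K1 := by positivity
  refine ⟨K1 + B + (Cν + K1 + 288), fun T hT => ?_⟩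
  have hT0 : 0 < T := by linarith
  have hT1 : 1 ≤ T := by linarith
  set N := ⌈9 * T⌉₊ with hN
  have hN9 : 9 * T ≤ N := Nat.le_ceil _
  have hN10 : (N : ℝ) ≤ 10 * T := by
    have := Nat.ceil_lt_add_one (a := 9 * T) (by positivity)
    linarith
  have hN1 : 1 ≤ N := by
    have : (1 : ℝ) ≤ N := by linarith
    exact_mod_cast this
  have hNpos : (0 : ℝ) < N := by linarith
  set γ := 1 - d / 2 with hγ
  have hTγ : 0 < T ^ γ := by positivity
  have hTγ1 : T ^ γ ≤ T := by
    calc T ^ γ ≤ T ^ (1 : ℝ) := Real.rpow_le_rpow_of_exponent_le hT1 (by rw [hγ]; linarith)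
      _ = T := Real.rpow_one T
  -- the diagonal tail
  have htail : Cν - ∑ n ∈ Finset.range N, c n ≤ B * T ^ (-(d / 2)) := by
    rw [hCν, ← hcsum.sum_add_tsum_nat_add N, add_sub_cancel_left]
    calc ∑' i, c (i + N) ≤ ∑' i, f (i + N) * T ^ (-(d / 2)) := by
          refine Summable.tsum_le_tsum (fun i => ?_) ((summable_nat_add_iff N).mpr hcsum)
            (((summable_nat_add_iff N).mpr hsum).mul_right _)
          rw [hcf]
          refine mul_le_mul_of_nonneg_left ?_ (hf0 _)
          have hi : T ≤ ((i + N : ℕ) : ℝ) + 1 := by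
            push_cast
            have : (0 : ℝ) ≤ i := by positivity
            linarith
          calc _ ≤ T ^ (-(3 * d / 4)) := Real.rpow_le_rpow_of_nonpos hT0 hi (by linarith)
            _ ≤ _ := Real.rpow_le_rpow_of_exponent_le hT1 (by linarith)
      _ = (∑' i, f (i + N)) * T ^ (-(d / 2)) := tsum_mul_right
      _ ≤ _ := by
          refine mul_le_mul_of_nonneg_right ?_ (by positivity)
          rw [hB, ← hsum.sum_add_tsum_nat_add N]
          linarith [Finset.sum_nonneg (s := Finset.range N) (fun i _ => hf0 i)]
  have hhead : ∑ n ∈ Finset.range N, c n ≤ Cν := hcsum.sum_le_tsum _ (fun n _ => hc0 n)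
  have htailT : |(∑ n ∈ Finset.range N, c n) * T - Cν * T| ≤ B * T ^ γ := by
    rw [← sub_mul, abs_mul, abs_sub_comm, abs_of_nonneg (by linarith : 0 ≤ Cν - _),
      abs_of_pos hT0]
    calc _ ≤ B * T ^ (-(d / 2)) * T := by gcongr
      _ = B * (T ^ (-(d / 2)) * T ^ (1 : ℝ)) := by rw [Real.rpow_one]; ring
      _ = _ := by rw [← Real.rpow_add hT0]; congr 2; rw [hγ]; ring
  -- the sum of squares
  have hS : ∑ n ∈ Finset.range N, cantorR (n + 1) ^ 2 ≤ B * (N : ℝ) ^ β := by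
    calc _ ≤ ∑ n ∈ Finset.range N, f n * (N : ℝ) ^ β := by
          refine Finset.sum_le_sum (fun n hn => ?_)
          have hn' : (n : ℝ) + 1 ≤ N := by exact_mod_cast Finset.mem_range.mp hn
          have hn0 : (0 : ℝ) < (n : ℝ) + 1 := by positivity
          have : cantorR (n + 1) ^ 2 = f n * ((n : ℝ) + 1) ^ β := by
            simp only [hf]
            rw [mul_assoc, ← Real.rpow_add hn0]; simp
          rw [this]
          refine mul_le_mul_of_nonneg_left ?_ (hf0 n)
          exact Real.rpow_le_rpow hn0.le hn' (by rw [hβ]; linarith)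
      _ = (∑ n ∈ Finset.range N, f n) * (N : ℝ) ^ β := by rw [Finset.sum_mul]
      _ ≤ _ := by
          refine mul_le_mul_of_nonneg_right ?_ (by positivity)
          exact hsum.sum_le_tsum _ (fun n _ => hf0 n)
  have hH := aux_H_le N hN1 (d / 4) (by linarith)
  have hNγ : (N : ℝ) ^ γ ≤ 10 * T ^ γ := by
    calc (N : ℝ) ^ γ ≤ (10 * T) ^ γ := Real.rpow_le_rpow hNpos.le hN10 (by rw [hγ]; linarith)
      _ = 10 ^ γ * T ^ γ := Real.mul_rpow (by norm_num) hT0.le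
      _ ≤ 10 ^ (1 : ℝ) * T ^ γ := by
          refine mul_le_mul_of_nonneg_right ?_ hTγ.le
          exact Real.rpow_le_rpow_of_exponent_le (by norm_num) (by rw [hγ]; linarith)
      _ = _ := by rw [Real.rpow_one]
  have hoff : 6 * ((∑ n ∈ Finset.range N, cantorR (n + 1) ^ 2) *
      ∑ i ∈ Finset.range N, 1 / ((i : ℝ) + 1)) ≤ K1 * T ^ γ := by
    calc _ ≤ 6 * ((B * (N : ℝ) ^ β) * ((1 + 1 / (d / 4)) * (N : ℝ) ^ (d / 4))) := by
          refine mul_le_mul_of_nonneg_left ?_ (by norm_num)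
          refine mul_le_mul hS hH (Finset.sum_nonneg fun i _ => by positivity) (by positivity)
      _ = 6 * B * (1 + 1 / (d / 4)) * ((N : ℝ) ^ β * (N : ℝ) ^ (d / 4)) := by ring
      _ = 6 * B * (1 + 1 / (d / 4)) * (N : ℝ) ^ γ := by
          rw [← Real.rpow_add hNpos]; congr 2; rw [hβ, hγ]; ring
      _ ≤ 6 * B * (1 + 1 / (d / 4)) * (10 * T ^ γ) := by gcongr
      _ = _ := by rw [hK1]; ring
  have hDmv := (aux_D_mv N T).trans hoff
  set ID := ∫ t in T..(2 * T), ‖auxD N (1 / 2 + t * Complex.I)‖ ^ 2 with hID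
  have hID_le : ID ≤ (Cν + K1) * T := by
    have h1 := (abs_le.mp hDmv).2
    have h2 : (∑ n ∈ Finset.range N, c n) * T ≤ Cν * T := by gcongr
    have h3 : K1 * T ^ γ ≤ K1 * T := by gcongr
    simp only [hc] at h2
    linarith
  -- comparison
  set δ := T ^ (-(1 / 2) : ℝ) with hδ
  have hδ0 : 0 < δ := by positivity
  have hδ1 : δ ≤ 1 := Real.rpow_le_one_of_one_le_of_nonpos hT1 (by norm_num)
  have hδT : δ * T ≤ T ^ γ := by
    calc δ * T = T ^ (-(1 / 2) : ℝ) * T ^ (1 : ℝ) := by rw [Real.rpow_one]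
      _ = T ^ (-(1 / 2) + 1 : ℝ) := (Real.rpow_add hT0 _ _).symm
      _ ≤ _ := Real.rpow_le_rpow_of_exponent_le hT1 (by rw [hγ]; linarith)
  have hcontL : Continuous (fun t : ℝ => ‖L (1 / 2 + t * Complex.I)‖ ^ 2) := by
    have := hL.continuous
    fun_prop
  have hcontD : Continuous (fun t : ℝ => ‖auxD N (1 / 2 + t * Complex.I)‖ ^ 2) := by
    unfold auxD
    refine (continuous_finsetSum _ (fun n _ => ?_)).norm.pow 2
    refine Continuous.mul continuous_const ?_
    refine Continuous.const_cpow (by fun_prop) (Or.inl ?_)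
    exact_mod_cast Nat.succ_ne_zero n
  have hpt : ∀ t ∈ Set.Ioc T (2 * T), ‖‖L (1 / 2 + t * Complex.I)‖ ^ 2 -
      ‖auxD N (1 / 2 + t * Complex.I)‖ ^ 2‖ ≤
      δ * ‖auxD N (1 / 2 + t * Complex.I)‖ ^ 2 + 288 * δ := by
    intro t ht
    have hre : (1 / 2 + t * Complex.I : ℂ).re = 1 / 2 := by simp
    have hnorm : ‖(1 / 2 + t * Complex.I : ℂ)‖ ≤ 1 / 2 + 2 * T := by
      refine (norm_add_le _ _).trans ?_
      rw [norm_mul, Complex.norm_I, mul_one, Complex.norm_real, Real.norm_eq_abs,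
        abs_of_pos (by linarith [ht.1])]
      have : ‖(1 / 2 : ℂ)‖ = 1 / 2 := by norm_num
      rw [this]
      linarith [ht.2]
    have h1 := aux_approx L hL hLeq (1 / 2 + t * Complex.I) (by rw [hre]; norm_num) N (by linarith)
    rw [hre] at h1
    have h2 : ((N : ℝ) + 1) ^ (-(1 / 2) : ℝ) ≤ δ :=
      Real.rpow_le_rpow_of_nonpos hT0 (by linarith) (by norm_num)
    have h3 := abs_norm_sub_norm_le (L (1 / 2 + t * Complex.I)) (auxD N (1 / 2 + t * Complex.I))
    have h4 : |‖L (1 / 2 + t * Complex.I)‖ - ‖auxD N (1 / 2 + t * Complex.I)‖| ≤ 12 * δ := by linarith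
    generalize ‖L (1 / 2 + t * Complex.I)‖ = x at h4 ⊢
    have hy := norm_nonneg (auxD N (1 / 2 + t * Complex.I))
    generalize ‖auxD N (1 / 2 + t * Complex.I)‖ = y at h4 hy ⊢
    rw [Real.norm_eq_abs, show x ^ 2 - y ^ 2 = (x - y) * (2 * y + (x - y)) by ring, abs_mul]
    have h5 : |2 * y + (x - y)| ≤ 2 * y + 12 * δ := by
      refine (abs_add_le _ _).trans ?_
      rw [abs_of_nonneg (by linarith : 0 ≤ 2 * y)]
      linarith
    calc _ ≤ 12 * δ * (2 * y + 12 * δ) := by gcongr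
      _ ≤ _ := by nlinarith [mul_nonneg hδ0.le (sq_nonneg (y - 12)), mul_nonneg hδ0.le (sub_nonneg.mpr hδ1)]
  have hcmp : |(∫ t in T..(2 * T), ‖L (1 / 2 + t * Complex.I)‖ ^ 2) - ID| ≤
      (Cν + K1 + 288) * T ^ γ := by
    rw [hID, ← intervalIntegral.integral_sub (hcontL.intervalIntegrable _ _)
      (hcontD.intervalIntegrable _ _), ← Real.norm_eq_abs]
    have h1 := intervalIntegral.norm_integral_le_of_norm_le (a := T) (b := 2 * T)
      (μ := MeasureTheory.volume) (by linarith)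
      (Filter.Eventually.of_forall hpt)
      (((continuous_const.mul hcontD).add continuous_const).intervalIntegrable _ _)
    refine h1.trans ?_
    rw [intervalIntegral.integral_add ((hcontD.intervalIntegrable _ _).const_mul _)
      (continuous_const.intervalIntegrable _ _), intervalIntegral.integral_const_mul, ← hID,
      intervalIntegral.integral_const, smul_eq_mul]
    calc δ * ID + (2 * T - T) * (288 * δ) ≤ δ * ((Cν + K1) * T) + (2 * T - T) * (288 * δ) := by gcongr
      _ = (Cν + K1 + 288) * (δ * T) := by ring
      _ ≤ _ := by gcongr
  have e1 := abs_sub_le (∫ t in T..(2 * T), ‖L (1 / 2 + t * Complex.I)‖ ^ 2) ID (Cν * T)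
  have e2 := abs_sub_le ID ((∑ n ∈ Finset.range N, c n) * T) (Cν * T)
  have e3 : |ID - (∑ n ∈ Finset.range N, c n) * T| ≤ K1 * T ^ γ := hDmv
  have e4 : (K1 + B + (Cν + K1 + 288)) * T ^ γ = K1 * T ^ γ + B * T ^ γ + (Cν + K1 + 288) * T ^ γ := by
    ring
  rw [e4]
  linarith
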